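/- Let 0 < p < 1/2 (asymmetric simple random walk with downward drift). Then E(M_n^+ · M_n^-) - p·n converges to -(2 - 3p)·p/(1 - 2p)^2 as n → ∞. -/

import Mathlib

open Finset Filter

/-- The value `±1` of a single step of the walk, driven by a Boolean. -/
def step (b : Bool) : ℤ := if b then 1 else -1

/-- The partial sum `S_j = X_1 + ⋯ + X_j` of the simple random walk driven by `ω`. -/
def walk {n : ℕ} (ω : Fin n → Bool) (j : ℕ) : ℤ :=
  ∑ i ∈ Finset.univ.filter fun i : Fin n => (i : ℕ) < j, step (ω i)

/-- `M_n^+ = max_{0 ≤ j ≤ n} S_j`. -/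
def mplus {n : ℕ} (ω : Fin n → Bool) : ℤ :=
  (Finset.range (n + 1)).sup' (by simp) (walk ω)

/-- `M_n^- = -min_{0 ≤ j ≤ n} S_j`. -/
def mminus {n : ℕ} (ω : Fin n → Bool) : ℤ :=
  -((Finset.range (n + 1)).inf' (by simp) (walk ω))

/-- The probability weight of the path `ω` when `P{Xᵢ = 1} = p`, `P{Xᵢ = -1} = 1 - p`,
independently over `i`. -/
def wt (p : ℝ) {n : ℕ} (ω : Fin n → Bool) : ℝ :=
  ∏ i, if ω i then p else 1 - p

/-- The probability of an event `A` for a walk of length `n`. -/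
noncomputable def prob (p : ℝ) {n : ℕ} (A : Set (Fin n → Bool)) : ℝ :=
  ∑ ω : Fin n → Bool, A.indicator (wt p) ω

/-- The expectation of a functional `f` of a walk of length `n`. -/
noncomputable def expectation (p : ℝ) {n : ℕ} (f : (Fin n → Bool) → ℝ) : ℝ :=
  ∑ ω : Fin n → Bool, wt p ω * f ω

section Expectation

variable {p : ℝ} {n : ℕ}

lemma expectation_add (f g : (Fin n → Bool) → ℝ) :
    expectation p (fun ω => f ω + g ω) = expectation p f + expectation p g := by
  simp only [expectation, mul_add, sum_add_distrib]

lemma expectation_sub (f g : (Fin n → Bool) → ℝ) :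
    expectation p (fun ω => f ω - g ω) = expectation p f - expectation p g := by
  simp only [expectation, mul_sub, sum_sub_distrib]

lemma expectation_const_mul (c : ℝ) (f : (Fin n → Bool) → ℝ) :
    expectation p (fun ω => c * f ω) = c * expectation p f := by
  simp only [expectation, mul_sum]
  exact sum_congr rfl fun _ _ => by ring

lemma expectation_mul_const (c : ℝ) (f : (Fin n → Bool) → ℝ) :
    expectation p (fun ω => f ω * c) = expectation p f * c := by
  simp only [expectation, sum_mul]
  exact sum_congr rfl fun _ _ => by ring

lemma wt_nonneg (hp0 : 0 ≤ p) (hp1 : p ≤ 1) (ω : Fin n → Bool) : 0 ≤ wt p ω :=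
  prod_nonneg fun i _ => by split_ifs <;> linarith

lemma expectation_mono (hp0 : 0 ≤ p) (hp1 : p ≤ 1) {f g : (Fin n → Bool) → ℝ}
    (h : ∀ ω, f ω ≤ g ω) : expectation p f ≤ expectation p g :=
  sum_le_sum fun ω _ => mul_le_mul_of_nonneg_left (h ω) (wt_nonneg hp0 hp1 ω)

lemma expectation_zero_length (f : (Fin 0 → Bool) → ℝ) : expectation p f = f default := by
  simp only [expectation, wt, univ_unique, sum_singleton, univ_eq_empty, prod_empty, one_mul]
  exact congrArg f (Subsingleton.elim _ _)

lemma expectation_cons (f : (Fin (n + 1) → Bool) → ℝ) :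
    expectation p f = p * expectation p (fun ω : Fin n → Bool => f (Fin.cons true ω)) +
      (1 - p) * expectation p (fun ω : Fin n → Bool => f (Fin.cons false ω)) := by
  have h : expectation p f = ∑ x : Bool × (Fin n → Bool),
      wt p (Fin.cons x.1 x.2 : Fin (n + 1) → Bool) * f (Fin.cons x.1 x.2) :=
    ((Fin.consEquiv fun _ => Bool).sum_comp fun ω => wt p ω * f ω).symm
  rw [h, Fintype.sum_prod_type]
  simp [expectation, wt, Fin.prod_univ_succ, mul_sum, mul_assoc]

lemma expectation_snoc (f : (Fin (n + 1) → Bool) → ℝ) :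
    expectation p f =
      p * expectation p (fun ω : Fin n → Bool => f (Fin.snoc (α := fun _ => Bool) ω true)) +
      (1 - p) *
        expectation p (fun ω : Fin n → Bool => f (Fin.snoc (α := fun _ => Bool) ω false)) := by
  have h : expectation p f = ∑ x : Bool × (Fin n → Bool),
      wt p (Fin.snoc (α := fun _ => Bool) x.2 x.1) * f (Fin.snoc (α := fun _ => Bool) x.2 x.1) :=
    ((Fin.snocEquiv fun _ => Bool).sum_comp fun ω => wt p ω * f ω).symm
  rw [h, Fintype.sum_prod_type]
  simp only [expectation, wt, Fin.prod_univ_castSucc, mul_sum, Fintype.sum_bool, Fin.snoc_castSucc,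
    Fin.snoc_last]
  congr 1 <;> exact sum_congr rfl fun _ _ => by simp; ring

lemma expectation_append {m k : ℕ} (f : (Fin (m + k) → Bool) → ℝ) :
    expectation p f = expectation p (fun a : Fin m → Bool =>
      expectation p (fun b : Fin k → Bool => f (Fin.append a b))) := by
  have h : expectation p f = ∑ x : (Fin m → Bool) × (Fin k → Bool),
      wt p (Fin.append x.1 x.2) * f (Fin.append x.1 x.2) :=
    ((Fin.appendEquiv m k).sum_comp fun ω => wt p ω * f ω).symm
  rw [h, Fintype.sum_prod_type]
  simp [expectation, wt, Fin.prod_univ_add, mul_sum, mul_assoc]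

lemma expectation_const (c : ℝ) : expectation p (fun _ : Fin n → Bool => c) = c := by
  induction n with
  | zero => rw [expectation_zero_length]
  | succ n ih => rw [expectation_cons, ih]; ring

end Expectation

section Walk

variable {n : ℕ}

lemma walk_zero (ω : Fin n → Bool) : walk ω 0 = 0 := by simp [walk]

lemma walk_cons_succ (b : Bool) (ω : Fin n → Bool) (j : ℕ) :
    walk (Fin.cons b ω : Fin (n + 1) → Bool) (j + 1) = step b + walk ω j := by
  simp [walk, sum_filter, Fin.sum_univ_succ]

lemma walk_append_left {m k : ℕ} (a : Fin m → Bool) (b : Fin k → Bool) {j : ℕ} (hj : j ≤ m) :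
    walk (Fin.append a b) j = walk a j := by
  simp only [walk, sum_filter, Fin.sum_univ_add, Fin.append_left, Fin.append_right,
    Fin.val_castAdd, Fin.val_natAdd]
  rw [add_eq_left]
  exact sum_eq_zero fun i _ => if_neg (by omega)

lemma walk_append_right {m k : ℕ} (a : Fin m → Bool) (b : Fin k → Bool) (j : ℕ) :
    walk (Fin.append a b) (m + j) = walk a m + walk b j := by
  simp only [walk, sum_filter, Fin.sum_univ_add, Fin.append_left, Fin.append_right,
    Fin.val_castAdd, Fin.val_natAdd, add_lt_add_iff_left]
  congr 1
  exact sum_congr rfl fun i _ => by rw [if_pos (by omega), if_pos i.2]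

lemma walk_snoc_of_le (ω : Fin n → Bool) (b : Bool) {j : ℕ} (hj : j ≤ n) :
    walk (Fin.snoc (α := fun _ => Bool) ω b) j = walk ω j := by
  rw [← Fin.append_right_eq_snoc ω (fun _ => b)]
  exact walk_append_left ω _ hj

lemma walk_snoc_last (ω : Fin n → Bool) (b : Bool) :
    walk (Fin.snoc (α := fun _ => Bool) ω b) (n + 1) = walk ω n + step b := by
  rw [← Fin.append_right_eq_snoc ω (fun _ => b), walk_append_right]
  simp [walk]

lemma mplus_le_iff {ω : Fin n → Bool} {c : ℤ} : mplus ω ≤ c ↔ ∀ j ≤ n, walk ω j ≤ c := by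
  simp [mplus]

lemma mminus_le_iff {ω : Fin n → Bool} {c : ℤ} : mminus ω ≤ c ↔ ∀ j ≤ n, -walk ω j ≤ c := by
  simp [mminus, neg_le]

lemma walk_le_mplus (ω : Fin n → Bool) {j : ℕ} (hj : j ≤ n) : walk ω j ≤ mplus ω :=
  mplus_le_iff.1 le_rfl j hj

lemma neg_walk_le_mminus (ω : Fin n → Bool) {j : ℕ} (hj : j ≤ n) : -walk ω j ≤ mminus ω :=
  mminus_le_iff.1 le_rfl j hj

lemma mplus_nonneg (ω : Fin n → Bool) : 0 ≤ mplus ω := by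
  simpa [walk_zero] using walk_le_mplus ω (Nat.zero_le n)

lemma mplus_zero_length (ω : Fin 0 → Bool) : mplus ω = 0 := by simp [mplus, walk_zero]

lemma mminus_zero_length (ω : Fin 0 → Bool) : mminus ω = 0 := by simp [mminus, walk_zero]

lemma forall_le_succ_iff {P : ℕ → Prop} :
    (∀ j ≤ n + 1, P j) ↔ (∀ j ≤ n, P j) ∧ P (n + 1) := by
  grind

lemma forall_le_succ_iff' {P : ℕ → Prop} :
    (∀ j ≤ n + 1, P j) ↔ P 0 ∧ ∀ j ≤ n, P (j + 1) := by
  refine ⟨fun h => ⟨h 0 (by omega), fun j hj => h _ (by omega)⟩, ?_⟩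
  rintro ⟨h0, h⟩ (_ | j) hj
  exacts [h0, h j (by omega)]

lemma mplus_cons (b : Bool) (ω : Fin n → Bool) :
    mplus (Fin.cons b ω : Fin (n + 1) → Bool) = max 0 (mplus ω + step b) := by
  refine eq_of_forall_ge_iff fun c => ?_
  rw [mplus_le_iff, forall_le_succ_iff', max_le_iff, walk_zero, ← le_sub_iff_add_le, mplus_le_iff]
  simp only [walk_cons_succ, le_sub_iff_add_le']

lemma mplus_snoc (ω : Fin n → Bool) (b : Bool) :
    mplus (Fin.snoc (α := fun _ => Bool) ω b) = max (mplus ω) (walk ω n + step b) := by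
  refine eq_of_forall_ge_iff fun c => ?_
  rw [mplus_le_iff, forall_le_succ_iff, max_le_iff, walk_snoc_last, mplus_le_iff]
  exact and_congr_left' (forall₂_congr fun j hj => by rw [walk_snoc_of_le ω b hj])

lemma mminus_snoc (ω : Fin n → Bool) (b : Bool) :
    mminus (Fin.snoc (α := fun _ => Bool) ω b) = max (mminus ω) (-(walk ω n + step b)) := by
  refine eq_of_forall_ge_iff fun c => ?_
  rw [mminus_le_iff, forall_le_succ_iff, max_le_iff, walk_snoc_last, mminus_le_iff]
  exact and_congr_left' (forall₂_congr fun j hj => by rw [walk_snoc_of_le ω b hj])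

/-- The maximum `max_{0 ≤ j ≤ n} (S_n - S_j)` of the reversed walk. -/
def revMax (ω : Fin n → Bool) : ℤ := mminus ω + walk ω n

lemma revMax_nonneg (ω : Fin n → Bool) : 0 ≤ revMax ω := by
  have := neg_walk_le_mminus ω le_rfl
  unfold revMax
  omega

lemma revMax_snoc (ω : Fin n → Bool) (b : Bool) :
    revMax (Fin.snoc (α := fun _ => Bool) ω b) = max 0 (revMax ω + step b) := by
  rw [revMax, revMax, mminus_snoc, walk_snoc_last]
  omega

lemma mplus_le_mplus_append {m k : ℕ} (a : Fin m → Bool) (b : Fin k → Bool) :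
    mplus a ≤ mplus (Fin.append a b) :=
  mplus_le_iff.2 fun j hj => by
    rw [← walk_append_left a b hj]
    exact walk_le_mplus _ (by omega)

lemma revMax_le_revMax_append {m k : ℕ} (a : Fin m → Bool) (b : Fin k → Bool) :
    revMax b ≤ revMax (Fin.append a b) := by
  have h : mminus b ≤ mminus (Fin.append a b) + walk a m := mminus_le_iff.2 fun j hj => by
    have := neg_walk_le_mminus (Fin.append a b) (Nat.add_le_add_left hj m)
    rw [walk_append_right] at this
    omega
  rw [revMax, revMax, walk_append_right]
  omega

end Walk

section Moments

variable {p : ℝ} {n : ℕ}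

/-- The mean of `g (M_n^+)`. -/
noncomputable def meanMax (p : ℝ) (g : ℤ → ℝ) (n : ℕ) : ℝ :=
  expectation p fun ω : Fin n → Bool => g (mplus ω)

lemma meanMax_succ (g : ℤ → ℝ) (n : ℕ) :
    meanMax p g (n + 1) = p * meanMax p (fun a => g (max 0 (a + 1))) n +
      (1 - p) * meanMax p (fun a => g (max 0 (a - 1))) n := by
  simp [meanMax, expectation_cons, mplus_cons, step, sub_eq_add_neg]

lemma expectation_revMax (g : ℤ → ℝ) (n : ℕ) :
    expectation p (fun ω : Fin n → Bool => g (revMax ω)) = meanMax p g n := by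
  induction n generalizing g with
  | zero =>
    simp [meanMax, expectation_zero_length, revMax, mplus_zero_length, mminus_zero_length,
      walk_zero]
  | succ n ih =>
    rw [meanMax_succ, ← ih, ← ih, expectation_snoc]
    simp [revMax_snoc, step, sub_eq_add_neg]

lemma meanMax_succ_of_reflect {g : ℤ → ℝ} (hg : g (-1) = g 0) (n : ℕ) :
    meanMax p g (n + 1) = meanMax p (fun a => p * g (a + 1) + (1 - p) * g (a - 1)) n := by
  rw [meanMax_succ]
  simp only [meanMax]
  rw [expectation_add, expectation_const_mul, expectation_const_mul]
  congr 3 <;> funext ω <;> have := mplus_nonneg ω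
  · rw [max_eq_right (by omega)]
  · rcases this.eq_or_lt with h | h
    · simp [← h, hg]
    · rw [max_eq_right (by omega)]

lemma meanMax_monotone (hp0 : 0 ≤ p) (hp1 : p ≤ 1) {g : ℤ → ℝ}
    (hg : ∀ a b : ℤ, 0 ≤ a → a ≤ b → g a ≤ g b) : Monotone (meanMax p g) := by
  refine monotone_nat_of_le_succ fun n => ?_
  have h (b : Bool) : meanMax p g n ≤ expectation p
      fun ω : Fin n → Bool => g (mplus (Fin.snoc (α := fun _ => Bool) ω b)) :=
    expectation_mono hp0 hp1 fun ω =>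
      hg _ _ (mplus_nonneg ω) (by rw [mplus_snoc]; exact le_max_left _ _)
  rw [meanMax.eq_1 p g (n + 1), expectation_snoc]
  nlinarith [h true, h false]

/-- The rising factorial `a (a + 1) ⋯ (a + k - 1)` of an integer, as a real number. -/
noncomputable def rising (k : ℕ) (a : ℤ) : ℝ := ∏ i ∈ range k, ((a : ℝ) + i)

lemma rising_mono (k : ℕ) (a b : ℤ) (ha : 0 ≤ a) (hab : a ≤ b) : rising k a ≤ rising k b := by
  have ha' : (0 : ℝ) ≤ a := by exact_mod_cast ha
  have hab' : (a : ℝ) ≤ b := by exact_mod_cast hab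
  exact prod_le_prod (fun i _ => by positivity) fun i _ => by linarith

lemma meanMax_rising_monotone (hp0 : 0 ≤ p) (hp1 : p ≤ 1) (k : ℕ) :
    Monotone (meanMax p (rising k)) :=
  meanMax_monotone hp0 hp1 (rising_mono k)

lemma meanMax_of_eq_rising {g : ℤ → ℝ} (c₀ c₁ c₂ c₃ c₄ : ℝ)
    (hg : ∀ a, g a = c₀ + c₁ * rising 1 a + c₂ * rising 2 a + c₃ * rising 3 a + c₄ * rising 4 a)
    (n : ℕ) :
    meanMax p g n = c₀ + c₁ * meanMax p (rising 1) n + c₂ * meanMax p (rising 2) n +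
      c₃ * meanMax p (rising 3) n + c₄ * meanMax p (rising 4) n := by
  simp only [meanMax, hg, expectation_add, expectation_const_mul, expectation_const]

lemma meanMax_rising_two_succ (n : ℕ) :
    meanMax p (rising 2) (n + 1) =
      meanMax p (rising 2) n + 2 * p - 2 * (1 - 2 * p) * meanMax p (rising 1) n := by
  rw [meanMax_succ_of_reflect (by simp [rising, prod_range_succ]),
    meanMax_of_eq_rising (2 * p) (-2 * (1 - 2 * p)) 1 0 0]
  · ring
  · intro a
    simp only [rising, prod_range_succ, prod_range_zero]
    push_cast
    ring

lemma meanMax_rising_three_succ (n : ℕ) :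
    meanMax p (rising 3) (n + 1) = meanMax p (rising 3) n + 6 * p + 6 * p * meanMax p (rising 1) n -
      3 * (1 - 2 * p) * meanMax p (rising 2) n := by
  rw [meanMax_succ_of_reflect (by simp [rising, prod_range_succ]),
    meanMax_of_eq_rising (6 * p) (6 * p) (-3 * (1 - 2 * p)) 1 0]
  · ring
  · intro a
    simp only [rising, prod_range_succ, prod_range_zero]
    push_cast
    ring

lemma meanMax_rising_four_succ (n : ℕ) :
    meanMax p (rising 4) (n + 1) = meanMax p (rising 4) n + 24 * p +
      24 * p * meanMax p (rising 1) n + 12 * p * meanMax p (rising 2) n -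
      4 * (1 - 2 * p) * meanMax p (rising 3) n := by
  rw [meanMax_succ_of_reflect (by simp [rising, prod_range_succ]),
    meanMax_of_eq_rising (24 * p) (24 * p) (12 * p) (-4 * (1 - 2 * p)) 1]
  · ring
  · intro a
    simp only [rising, prod_range_succ, prod_range_zero]
    push_cast
    ring

lemma meanMax_rising_one_le (hp0 : 0 < p) (hp1 : p < 1 / 2) (n : ℕ) :
    meanMax p (rising 1) n ≤ p / (1 - 2 * p) := by
  have h := meanMax_rising_monotone hp0.le (by linarith) 2 n.le_succ
  rw [Nat.succ_eq_add_one, meanMax_rising_two_succ] at h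
  rw [le_div_iff₀ (by linarith)]
  linarith

lemma exists_meanMax_rising_two_le (hp0 : 0 < p) (hp1 : p < 1 / 2) :
    ∃ C, ∀ n, meanMax p (rising 2) n ≤ C := by
  refine ⟨(6 * p + 6 * p * (p / (1 - 2 * p))) / (3 * (1 - 2 * p)), fun n => ?_⟩
  have h := meanMax_rising_monotone hp0.le (by linarith) 3 n.le_succ
  rw [Nat.succ_eq_add_one, meanMax_rising_three_succ] at h
  rw [le_div_iff₀ (by linarith)]
  linarith [mul_le_mul_of_nonneg_left (meanMax_rising_one_le hp0 hp1 n) (by linarith : 0 ≤ 6 * p)]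

lemma exists_meanMax_rising_three_le (hp0 : 0 < p) (hp1 : p < 1 / 2) :
    ∃ C, ∀ n, meanMax p (rising 3) n ≤ C := by
  obtain ⟨C, hC⟩ := exists_meanMax_rising_two_le hp0 hp1
  refine ⟨(24 * p + 24 * p * (p / (1 - 2 * p)) + 12 * p * C) / (4 * (1 - 2 * p)), fun n => ?_⟩
  have h := meanMax_rising_monotone hp0.le (by linarith) 4 n.le_succ
  rw [Nat.succ_eq_add_one, meanMax_rising_four_succ] at h
  rw [le_div_iff₀ (by linarith)]
  linarith [mul_le_mul_of_nonneg_left (meanMax_rising_one_le hp0 hp1 n) (by linarith : 0 ≤ 24 * p),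
    mul_le_mul_of_nonneg_left (hC n) (by linarith : 0 ≤ 12 * p)]

lemma tendsto_succ_sub_self_of_monotone {u : ℕ → ℝ} (hu : Monotone u) (hb : ∃ C, ∀ n, u n ≤ C) :
    Tendsto (fun n => u (n + 1) - u n) atTop (nhds 0) := by
  obtain ⟨C, hC⟩ := hb
  have h := tendsto_atTop_ciSup hu ⟨C, by rintro _ ⟨n, rfl⟩; exact hC n⟩
  simpa using (h.comp (tendsto_add_atTop_nat 1)).sub h

lemma tendsto_meanMax_rising_one (hp0 : 0 < p) (hp1 : p < 1 / 2) :
    Tendsto (meanMax p (rising 1)) atTop (nhds (p / (1 - 2 * p))) := by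
  have hd : 1 - 2 * p ≠ 0 := by linarith
  have h := tendsto_succ_sub_self_of_monotone
    (meanMax_rising_monotone hp0.le (by linarith) 2) (exists_meanMax_rising_two_le hp0 hp1)
  convert (h.const_sub (2 * p)).div_const (2 * (1 - 2 * p)) using 2 with n
  · rw [meanMax_rising_two_succ]; field_simp; ring
  · field_simp; ring

lemma tendsto_meanMax_rising_two (hp0 : 0 < p) (hp1 : p < 1 / 2) :
    Tendsto (meanMax p (rising 2)) atTop (nhds (2 * p * (1 - p) / (1 - 2 * p) ^ 2)) := by
  have hd : 1 - 2 * p ≠ 0 := by linarith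
  have h := tendsto_succ_sub_self_of_monotone
    (meanMax_rising_monotone hp0.le (by linarith) 3) (exists_meanMax_rising_three_le hp0 hp1)
  convert ((((tendsto_meanMax_rising_one hp0 hp1).const_mul (6 * p)).const_add (6 * p)).sub h
    ).div_const (3 * (1 - 2 * p)) using 2 with n
  · rw [meanMax_rising_three_succ, eq_div_iff (by positivity)]; ring
  · field_simp; ring

lemma meanMax_sq (n : ℕ) : meanMax p (fun a => (a : ℝ) ^ 2) n =
    meanMax p (rising 2) n - meanMax p (rising 1) n := by
  simp only [meanMax]
  rw [← expectation_sub]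
  congr 1; funext ω
  simp [rising, prod_range_succ]
  ring

/-- The exact second-order identity `E(M_n^+ S_n) = E(M_n^+ (M_n^+ + 1)) - p n`. -/
lemma expectation_mplus_mul_walk (n : ℕ) :
    expectation p (fun ω : Fin n → Bool => (mplus ω : ℝ) * (walk ω n : ℝ)) =
      meanMax p (rising 2) n - p * n := by
  induction n with
  | zero => simp [meanMax, expectation_zero_length, mplus_zero_length, rising, prod_range_succ]
  | succ n ih =>
    have hrec := meanMax_rising_two_succ (p := p) n
    have hS : meanMax p (rising 2) (n + 1) = _ := expectation_snoc _
    rw [expectation_snoc]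
    have key (b : Bool) : expectation p (fun ω : Fin n → Bool =>
          (mplus (Fin.snoc (α := fun _ => Bool) ω b) : ℝ) *
            (walk (Fin.snoc (α := fun _ => Bool) ω b) (n + 1) : ℝ)) =
        expectation p (fun ω : Fin n → Bool => (mplus ω : ℝ) * (walk ω n : ℝ)) +
          step b * meanMax p (rising 1) n +
          1 / 2 * (expectation p (fun ω : Fin n → Bool =>
            rising 2 (mplus (Fin.snoc (α := fun _ => Bool) ω b))) - meanMax p (rising 2) n) := by
      simp only [meanMax]
      rw [← expectation_const_mul, ← expectation_sub, ← expectation_const_mul, ← expectation_add,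
        ← expectation_add]
      congr 1; funext ω
      rw [mplus_snoc, walk_snoc_last]
      simp only [rising, prod_range_succ, prod_range_zero]
      have hle := walk_le_mplus ω le_rfl
      have hb : step b ≤ 1 := by cases b <;> simp [step]
      rcases le_or_gt (walk ω n + step b) (mplus ω) with h | h
      · rw [max_eq_left h]; push_cast; ring
      · have h' : walk ω n = mplus ω := by omega
        have h1 : step b = 1 := by omega
        rw [max_eq_right h.le, h', h1]; push_cast; ring
    rw [key, key, ih]
    simp only [step]
    push_cast
    simp
    linarith

lemma expectation_mplus_mul_mminus (n : ℕ) :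
    expectation p (fun ω : Fin n → Bool => (mplus ω : ℝ) * (mminus ω : ℝ)) - p * n =
      expectation p (fun ω : Fin n → Bool => (mplus ω : ℝ) * (revMax ω : ℝ)) -
        meanMax p (rising 2) n := by
  have h := expectation_mplus_mul_walk (p := p) n
  have h2 : expectation p (fun ω : Fin n → Bool => (mplus ω : ℝ) * (mminus ω : ℝ)) =
      expectation p (fun ω : Fin n → Bool => (mplus ω : ℝ) * (revMax ω : ℝ)) -
      expectation p (fun ω : Fin n → Bool => (mplus ω : ℝ) * (walk ω n : ℝ)) := by
    rw [← expectation_sub]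
    congr 1; funext ω
    simp [revMax]
    ring
  linarith

lemma expectation_mplus_mul_revMax_append (m k : ℕ) :
    expectation p (fun a : Fin m → Bool => expectation p (fun b : Fin k → Bool =>
      (mplus a : ℝ) * (revMax b : ℝ))) = meanMax p (rising 1) m * meanMax p (rising 1) k := by
  simp only [expectation_const_mul, expectation_mul_const]
  rw [expectation_revMax (fun a => (a : ℝ))]
  simp [meanMax, rising]

lemma le_expectation_mplus_mul_revMax (hp0 : 0 ≤ p) (hp1 : p ≤ 1) (m k : ℕ) :
    meanMax p (rising 1) m * meanMax p (rising 1) k ≤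
      expectation p (fun ω : Fin (m + k) → Bool => (mplus ω : ℝ) * (revMax ω : ℝ)) := by
  rw [expectation_append, ← expectation_mplus_mul_revMax_append]
  refine expectation_mono hp0 hp1 fun a => expectation_mono hp0 hp1 fun b => ?_
  exact_mod_cast mul_le_mul (mplus_le_mplus_append a b) (revMax_le_revMax_append a b)
    (revMax_nonneg b) (mplus_nonneg _)

lemma mul_le_mul_add_of_le {x y x' y' ε : ℝ} (hε : 0 < ε) (hx : 0 ≤ x) (hxx : x ≤ x')
    (hy : 0 ≤ y) (hyy : y ≤ y') :
    x' * y' ≤ x * y + ε⁻¹ / 2 * ((x' ^ 2 - x ^ 2) + (y' ^ 2 - y ^ 2)) +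
      ε / 2 * (x ^ 2 + y' ^ 2) := by
  have amgm {u v w : ℝ} (hu : u ^ 2 ≤ w) : u * v ≤ ε⁻¹ / 2 * w + ε / 2 * v ^ 2 := by
    have h : 0 ≤ ε⁻¹ / 2 * (u - ε * v) ^ 2 := by positivity
    have h' : ε⁻¹ / 2 * (u - ε * v) ^ 2 = ε⁻¹ / 2 * u ^ 2 + ε / 2 * v ^ 2 - u * v := by
      field_simp; ring
    have h'' : ε⁻¹ / 2 * u ^ 2 ≤ ε⁻¹ / 2 * w := by gcongr
    linarith
  have h1 := amgm (u := x' - x) (v := y') (w := x' ^ 2 - x ^ 2) (by nlinarith)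
  have h2 := amgm (u := y' - y) (v := x) (w := y' ^ 2 - y ^ 2) (by nlinarith)
  linarith

lemma expectation_mplus_mul_revMax_le (hp0 : 0 ≤ p) (hp1 : p ≤ 1) (m k : ℕ) {ε : ℝ}
    (hε : 0 < ε) :
    expectation p (fun ω : Fin (m + k) → Bool => (mplus ω : ℝ) * (revMax ω : ℝ)) ≤
      meanMax p (rising 1) m * meanMax p (rising 1) k +
      ε⁻¹ / 2 * ((meanMax p (fun a => (a : ℝ) ^ 2) (m + k) - meanMax p (fun a => (a : ℝ) ^ 2) m) +
        (meanMax p (fun a => (a : ℝ) ^ 2) (m + k) - meanMax p (fun a => (a : ℝ) ^ 2) k)) +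
      ε / 2 * (meanMax p (fun a => (a : ℝ) ^ 2) m + meanMax p (fun a => (a : ℝ) ^ 2) (m + k)) := by
  have hm : meanMax p (fun a => (a : ℝ) ^ 2) m = expectation p (fun a : Fin m → Bool =>
      expectation p (fun _ : Fin k → Bool => (mplus a : ℝ) ^ 2)) := by
    simp only [expectation_const, meanMax]
  have hk : meanMax p (fun a => (a : ℝ) ^ 2) k = expectation p (fun _ : Fin m → Bool =>
      expectation p (fun b : Fin k → Bool => (revMax b : ℝ) ^ 2)) := by
    rw [expectation_const, expectation_revMax fun a => (a : ℝ) ^ 2]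
  have hM : meanMax p (fun a => (a : ℝ) ^ 2) (m + k) = expectation p (fun a : Fin m → Bool =>
      expectation p (fun b : Fin k → Bool => (mplus (Fin.append a b) : ℝ) ^ 2)) :=
    expectation_append _
  have hL : meanMax p (fun a => (a : ℝ) ^ 2) (m + k) = expectation p (fun a : Fin m → Bool =>
      expectation p (fun b : Fin k → Bool => (revMax (Fin.append a b) : ℝ) ^ 2)) := by
    rw [← expectation_revMax fun a => (a : ℝ) ^ 2, expectation_append]
  have h := expectation_mono hp0 hp1 fun a : Fin m → Bool => expectation_mono hp0 hp1
    fun b : Fin k → Bool => mul_le_mul_add_of_le hε (Int.cast_nonneg (R := ℝ) (mplus_nonneg a))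
      (Int.cast_le.2 (mplus_le_mplus_append a b)) (Int.cast_nonneg (revMax_nonneg b))
      (Int.cast_le.2 (revMax_le_revMax_append a b))
  rw [← expectation_append (fun ω : Fin (m + k) → Bool => (mplus ω : ℝ) * (revMax ω : ℝ))] at h
  simp only [expectation_add, expectation_sub, expectation_const_mul, expectation_mul_const] at h
  have hprod := expectation_mplus_mul_revMax_append (p := p) m k
  simp only [expectation_const_mul, expectation_mul_const] at hprod
  rw [hprod, ← hm, ← hk, ← hM, ← hL] at h
  exact h

lemma tendsto_expectation_mplus_mul_revMax (hp0 : 0 < p) (hp1 : p < 1 / 2) :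
    Tendsto (fun n : ℕ => expectation p
      (fun ω : Fin n → Bool => (mplus ω : ℝ) * (revMax ω : ℝ))) atTop
      (nhds ((p / (1 - 2 * p)) ^ 2)) := by
  set C : ℕ → ℝ := fun n : ℕ => expectation p
      (fun ω : Fin n → Bool => (mplus ω : ℝ) * (revMax ω : ℝ))
  set s := meanMax p (fun a => (a : ℝ) ^ 2) with hs
  have hsum (n : ℕ) : n / 2 + (n - n / 2) = n := by omega
  have half : Tendsto (fun n : ℕ => n / 2) atTop atTop :=
    Nat.tendsto_div_const_atTop two_ne_zero
  have half' : Tendsto (fun n : ℕ => n - n / 2) atTop atTop :=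
    tendsto_atTop_mono (fun n => by omega) half
  have he := tendsto_meanMax_rising_one hp0 hp1
  obtain ⟨σ, hσ⟩ : ∃ σ, Tendsto s atTop (nhds σ) :=
    ⟨_, ((tendsto_meanMax_rising_two hp0 hp1).sub he).congr fun n => (meanMax_sq n).symm⟩
  have hprod := (he.comp half).mul (he.comp half')
  rw [← pow_two] at hprod
  refine tendsto_order.2 ⟨fun c hc => ?_, fun c hc => ?_⟩
  · filter_upwards [hprod.eventually_const_lt hc] with n hn
    have := le_expectation_mplus_mul_revMax hp0.le (by linarith) (n / 2) (n - n / 2)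
    exact hn.trans_le (this.trans_eq (congrArg C (hsum n)))
  · obtain ⟨ε, hε, hlt⟩ : ∃ ε > 0, (p / (1 - 2 * p)) ^ 2 + ε / 2 * (σ + σ) < c := by
      have : Tendsto (fun ε : ℝ => (p / (1 - 2 * p)) ^ 2 + ε / 2 * (σ + σ))
          (nhdsWithin 0 (Set.Ioi 0)) (nhds ((p / (1 - 2 * p)) ^ 2 + 0 / 2 * (σ + σ))) :=
        Tendsto.mono_left (Continuous.tendsto (by fun_prop) 0) nhdsWithin_le_nhds
      obtain ⟨ε, h1, h2⟩ :=
        ((this.eventually_lt_const (by simpa using hc)).and self_mem_nhdsWithin).exists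
      exact ⟨ε, h2, h1⟩
    have hub := (hprod.add (((hσ.sub (hσ.comp half)).add
      (hσ.sub (hσ.comp half'))).const_mul (ε⁻¹ / 2))).add
      (((hσ.comp half).add hσ).const_mul (ε / 2))
    simp only [sub_self, add_zero, mul_zero] at hub
    filter_upwards [hub.eventually_lt_const hlt] with n hn
    have := expectation_mplus_mul_revMax_le hp0.le (by linarith) (n / 2) (n - n / 2) hε
    rw [← hs, hsum] at this
    exact this.trans_lt hn

end Moments

theorem statement8 (p : ℝ) (hp0 : 0 < p) (hp1 : p < 1/2) :
    Tendsto
      (fun n : ℕ =>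
        expectation p (fun ω : Fin n → Bool => (mplus ω : ℝ) * (mminus ω : ℝ)) - p * n)
      atTop (nhds (-((2 - 3 * p) * p / (1 - 2 * p) ^ 2))) := by
  have hd : 1 - 2 * p ≠ 0 := by linarith
  simp only [expectation_mplus_mul_mminus]
  convert (tendsto_expectation_mplus_mul_revMax hp0 hp1).sub
    (tendsto_meanMax_rising_two hp0 hp1) using 2
  field_simp
  ring
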